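/- For every a ∈ ℝ and every α > 0, γ > 0, there exists a unique θ ∈ ℝ such that ψ(θ) = a + (α/γ)·θ. -/

import Mathlib

open MeasureTheory
open scoped ENNReal

/-- Partition function `Z(θ) = ∫ exp(−θρ) dπ` of the exponential tilt. -/
noncomputable def partitionZ {Λ : Type*} [MeasurableSpace Λ] (π : Measure Λ) (ρ : Λ → ℝ)
    (θ : ℝ) : ℝ :=
  ∫ x, Real.exp (-θ * ρ x) ∂π

/-- Exponentially tilted (Gibbs) measure `dμ_θ/dπ = exp(−θρ)/Z(θ)`. -/
noncomputable def gibbsTilt {Λ : Type*} [MeasurableSpace Λ] (π : Measure Λ) (ρ : Λ → ℝ)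
    (θ : ℝ) : Measure Λ :=
  π.withDensity (fun x => ENNReal.ofReal (Real.exp (-θ * ρ x) / partitionZ π ρ θ))

/-- Tilted mean `ψ(θ) = ∫ ρ dμ_θ`. -/
noncomputable def tiltMean {Λ : Type*} [MeasurableSpace Λ] (π : Measure Λ) (ρ : Λ → ℝ)
    (θ : ℝ) : ℝ :=
  ∫ x, ρ x ∂(gibbsTilt π ρ θ)

open ProbabilityTheory in
/-- A bounded measurable function has exponential moments of all orders. -/
theorem integrableExpSet_eq_univ_of_abs_le {Λ : Type*} [MeasurableSpace Λ] {π : Measure Λ}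
    [IsFiniteMeasure π] {ρ : Λ → ℝ} (hρ : Measurable ρ) {B : ℝ} (hB : ∀ x, |ρ x| ≤ B) :
    integrableExpSet ρ π = Set.univ :=
  Set.eq_univ_of_forall fun _ ↦ integrable_exp_mul_of_mem_Icc hρ.aemeasurable
    (Filter.Eventually.of_forall fun x ↦ abs_le.mp (hB x))

theorem gibbsTilt_eq_tilted {Λ : Type*} [MeasurableSpace Λ] (π : Measure Λ) (ρ : Λ → ℝ) (θ : ℝ) :
    gibbsTilt π ρ θ = π.tilted (fun x ↦ -θ * ρ x) :=
  rfl

open ProbabilityTheory in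
/-- The tilted mean is the derivative of the cumulant generating function at `-θ`. -/
theorem tiltMean_eq_deriv_cgf {Λ : Type*} [MeasurableSpace Λ] {π : Measure Λ}
    [IsFiniteMeasure π] {ρ : Λ → ℝ} (hρ : Measurable ρ) {B : ℝ} (hB : ∀ x, |ρ x| ≤ B) (θ : ℝ) :
    tiltMean π ρ θ = deriv (cgf ρ π) (-θ) := by
  rw [tiltMean, gibbsTilt_eq_tilted]
  exact integral_tilted_mul_self (by simp [integrableExpSet_eq_univ_of_abs_le hρ hB])

open ProbabilityTheory in
theorem differentiable_deriv_cgf_of_abs_le {Λ : Type*} [MeasurableSpace Λ] {π : Measure Λ}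
    [IsFiniteMeasure π] {ρ : Λ → ℝ} (hρ : Measurable ρ) {B : ℝ} (hB : ∀ x, |ρ x| ≤ B) :
    Differentiable ℝ (deriv (cgf ρ π)) := fun _ ↦
  (analyticAt_cgf (by simp [integrableExpSet_eq_univ_of_abs_le hρ hB])).deriv.differentiableAt

open ProbabilityTheory in
theorem monotone_deriv_cgf_of_abs_le {Λ : Type*} [MeasurableSpace Λ] {π : Measure Λ}
    [IsFiniteMeasure π] {ρ : Λ → ℝ} (hρ : Measurable ρ) {B : ℝ} (hB : ∀ x, |ρ x| ≤ B) :
    Monotone (deriv (cgf ρ π)) := by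
  refine monotone_of_deriv_nonneg (differentiable_deriv_cgf_of_abs_le hρ hB) fun t ↦ ?_
  have ht : t ∈ interior (integrableExpSet ρ π) := by
    simp [integrableExpSet_eq_univ_of_abs_le hρ hB]
  have h := variance_tilted_mul ht
  rw [iteratedDeriv_succ, iteratedDeriv_one] at h
  exact h ▸ variance_nonneg _ _

theorem continuous_tiltMean {Λ : Type*} [MeasurableSpace Λ] {π : Measure Λ}
    [IsFiniteMeasure π] {ρ : Λ → ℝ} (hρ : Measurable ρ) {B : ℝ} (hB : ∀ x, |ρ x| ≤ B) :
    Continuous (tiltMean π ρ) := by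
  rw [funext (tiltMean_eq_deriv_cgf hρ hB)]
  exact (differentiable_deriv_cgf_of_abs_le hρ hB).continuous.comp continuous_neg

theorem antitone_tiltMean {Λ : Type*} [MeasurableSpace Λ] {π : Measure Λ}
    [IsFiniteMeasure π] {ρ : Λ → ℝ} (hρ : Measurable ρ) {B : ℝ} (hB : ∀ x, |ρ x| ≤ B) :
    Antitone (tiltMean π ρ) := by
  intro s t hst
  rw [tiltMean_eq_deriv_cgf hρ hB, tiltMean_eq_deriv_cgf hρ hB]
  exact monotone_deriv_cgf_of_abs_le hρ hB (neg_le_neg hst)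

theorem abs_tiltMean_le {Λ : Type*} [MeasurableSpace Λ] {π : Measure Λ}
    [IsProbabilityMeasure π] {ρ : Λ → ℝ} (hρ : Measurable ρ) {B : ℝ} (hB : ∀ x, |ρ x| ≤ B)
    (θ : ℝ) : |tiltMean π ρ θ| ≤ B := by
  have hθ : -θ ∈ ProbabilityTheory.integrableExpSet ρ π := by
    simp [integrableExpSet_eq_univ_of_abs_le hρ hB]
  have := isProbabilityMeasure_tilted hθ
  rw [tiltMean, gibbsTilt_eq_tilted]
  simpa only [probReal_univ, mul_one, Real.norm_eq_abs] using
    norm_integral_le_of_norm_le_const (f := ρ) (μ := π.tilted (fun x ↦ -θ * ρ x))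
      (Filter.Eventually.of_forall hB)

/-- existence and uniqueness of the fixed point. For every `a ∈ ℝ` and all
`α, γ > 0` there exists a unique `θ ∈ ℝ` with `ψ(θ) = a + (α/γ)θ`. -/
theorem existsUnique_tilt_fixed_point
    {Λ : Type*} [MeasurableSpace Λ] [StandardBorelSpace Λ]
    (π : Measure Λ) [IsProbabilityMeasure π]
    (ρ : Λ → ℝ) (hρmeas : Measurable ρ) (B : ℝ) (hρbdd : ∀ x, |ρ x| ≤ B)
    (a α γ : ℝ) (hα : 0 < α) (hγ : 0 < γ) :
    ∃! θ : ℝ, tiltMean π ρ θ = a + α / γ * θ := by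
  have hc : 0 < α / γ := div_pos hα hγ
  have hbdd θ := abs_le.mp (abs_tiltMean_le (π := π) hρmeas hρbdd θ)
  have hcont : Continuous fun θ ↦ tiltMean π ρ θ - α / γ * θ :=
    (continuous_tiltMean hρmeas hρbdd).sub (by fun_prop)
  have hlow : tiltMean π ρ ((B - a) / (α / γ)) - α / γ * ((B - a) / (α / γ)) ≤ a := by
    rw [mul_div_cancel₀ _ hc.ne']
    linarith [(hbdd ((B - a) / (α / γ))).2]
  have hhigh : a ≤ tiltMean π ρ ((-B - a) / (α / γ)) - α / γ * ((-B - a) / (α / γ)) := by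
    rw [mul_div_cancel₀ _ hc.ne']
    linarith [(hbdd ((-B - a) / (α / γ))).1]
  have hanti : StrictAnti fun θ ↦ tiltMean π ρ θ - α / γ * θ := by
    intro s t hst
    linarith [antitone_tiltMean (π := π) hρmeas hρbdd hst.le, mul_lt_mul_of_pos_left hst hc]
  obtain ⟨θ, hθ⟩ := mem_range_of_exists_le_of_exists_ge hcont ⟨_, hlow⟩ ⟨_, hhigh⟩
  refine ⟨θ, sub_eq_iff_eq_add.mp hθ, fun t ht ↦ hanti.injective ?_⟩
  exact (sub_eq_iff_eq_add.mpr ht).trans hθ.symm
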